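/- Assume Assumption A.1 holds for the given univariate quadrature family. Then for every finite downward closed set Λ ⊆ F and every ν ∈ F, the sparse quadrature of the multivariate Hermite polynomial localizes: Q_Λ(H_ν) = Q_{Λ∩R_ν}(H_ν). Equivalently, Δ_μ(H_ν) = 0 for every μ ∈ F that does not satisfy μ ⪯ ν. -/

import Mathlib

open MeasureTheory ProbabilityTheory

/-- The standard Gaussian probability measure `γ₁` on `ℝ`. -/
noncomputable def stdGaussian : Measure ℝ := gaussianReal 0 1

/-- The orthonormal probabilists' Hermite polynomial `H_n(x) = He_n(x)/√(n!)`. -/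
noncomputable def Hnorm (n : ℕ) (x : ℝ) : ℝ :=
  (Polynomial.aeval x (Polynomial.hermite n)) / Real.sqrt (Nat.factorial n)

/-- A family of univariate quadrature rules: at level `l`, `m l` nodes and weights. -/
structure QuadFamily where
  m : ℕ → ℕ
  node : ℕ → ℕ → ℝ
  weight : ℕ → ℕ → ℝ

variable {E : Type*} [NormedAddCommGroup E] [NormedSpace ℝ E]

/-- The univariate quadrature `Q_l(f) = Σ_k w_k^l f(y_k^l)`. -/
noncomputable def QuadFamily.quad (Q : QuadFamily) (l : ℕ) (f : ℝ → E) : E :=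
  ∑ k ∈ Finset.range (Q.m l), Q.weight l k • f (Q.node l k)

/-- Assumption A.1: `Q_l` integrates exactly every polynomial of degree `≤ l`
against the standard Gaussian measure. -/
def QuadFamily.ExactA1 (Q : QuadFamily) : Prop :=
  ∀ l : ℕ, ∀ p : Polynomial ℝ, p.natDegree ≤ l →
    Q.quad l (fun x => p.eval x) = ∫ x, p.eval x ∂stdGaussian

/-- Assumption A.2: `|Q_l(H_n)| < 2` for all levels `l` and degrees `n`. -/
def QuadFamily.BoundedA2 (Q : QuadFamily) : Prop :=
  ∀ l n : ℕ, |Q.quad l (Hnorm n)| < 2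

/-- Tensor-product quadrature over the finite set `s` of dimensions, at levels `lev j`,
applied to `f : ℝ^ℕ → E`, coordinates outside `s` being evaluated at `0`. -/
noncomputable def QuadFamily.tensor (Q : QuadFamily) (s : Finset ℕ) (lev : ℕ → ℕ)
    (f : (ℕ → ℝ) → E) : E :=
  ∑ k ∈ s.pi (fun j => Finset.range (Q.m (lev j))),
    (∏ j ∈ s.attach, Q.weight (lev j.1) (k j.1 j.2)) •
      f (fun j => if h : j ∈ s then Q.node (lev j) (k j h) else 0)

/-- The tensorized difference operator
`Δ_ν = ⊗_{j ∈ supp ν} (Q_{ν_j} - Q_{ν_j - 1})`, expanded as the alternating-sign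
sum over subsets `T ⊆ supp ν` of the tensor quadrature at levels `ν - 1_T`. -/
noncomputable def QuadFamily.delta (Q : QuadFamily) (ν : ℕ →₀ ℕ) (f : (ℕ → ℝ) → E) : E :=
  ∑ T ∈ ν.support.powerset, (-1 : ℝ) ^ T.card •
    Q.tensor ν.support (fun j => ν j - (if j ∈ T then 1 else 0)) f

/-- The sparse quadrature `Q_Λ(f) = Σ_{ν ∈ Λ} Δ_ν(f)`. -/
noncomputable def QuadFamily.sparse (Q : QuadFamily) (Λ : Finset (ℕ →₀ ℕ))
    (f : (ℕ → ℝ) → E) : E :=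
  ∑ ν ∈ Λ, Q.delta ν f

/-- The multivariate Hermite polynomial `H_ν(y) = ∏_{j ∈ supp ν} H_{ν_j}(y_j)`. -/
noncomputable def Hmulti (ν : ℕ →₀ ℕ) (y : ℕ → ℝ) : ℝ :=
  ∏ j ∈ ν.support, Hnorm (ν j) (y j)

/-- A set of multi-indices is downward closed (admissible). -/
def DownwardClosed (Λ : Set (ℕ →₀ ℕ)) : Prop :=
  ∀ ν ∈ Λ, ∀ μ : ℕ →₀ ℕ, μ ≤ ν → μ ∈ Λ

/-- `γ` is the countable product of standard Gaussian measures on `ℝ^ℕ`: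
a probability measure whose finite-dimensional marginals are products of `γ₁`. -/
def IsProductGaussian (γ : Measure (ℕ → ℝ)) : Prop :=
  IsProbabilityMeasure γ ∧
  ∀ n : ℕ, γ.map (fun y (i : Fin n) => y (i : ℕ)) =
    Measure.pi (fun _ : Fin n => stdGaussian)

/-- The weight `b_ν = ∏_j Σ_{l=0}^r binom(ν_j, l) τ_j^{2l}` (a finite product over `supp ν`). -/
noncomputable def bwt (r : ℕ) (τ : ℕ → ℝ) (ν : ℕ →₀ ℕ) : ℝ :=
  ∏ j ∈ ν.support, ∑ l ∈ Finset.range (r + 1), ((ν j).choose l : ℝ) * τ j ^ (2 * l)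

/-- The weight `c_ν = ∏_{j ∈ supp ν} (1 + ν_j)³`. -/
noncomputable def cwt (ν : ℕ →₀ ℕ) : ℝ :=
  ∏ j ∈ ν.support, ((1 : ℝ) + ν j) ^ 3

lemma Hnorm_zero' (x : ℝ) : Hnorm 0 x = 1 := by simp [Hnorm]

lemma quad_Hnorm_eq (Q : QuadFamily) (hA1 : Q.ExactA1) {l n : ℕ} (h : n ≤ l) :
    Q.quad l (Hnorm n) = ∫ x, Hnorm n x ∂stdGaussian := by
  have key : Hnorm n = fun x => (Polynomial.C ((Real.sqrt (Nat.factorial n))⁻¹) *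
      (Polynomial.hermite n).map (Int.castRingHom ℝ)).eval x := by
    funext x
    simp only [Hnorm, Polynomial.eval_mul, Polynomial.eval_C, Polynomial.eval_map]
    rw [div_eq_inv_mul, Polynomial.aeval_def]
    rfl
  rw [key]
  apply hA1
  refine (Polynomial.natDegree_C_mul_le _ _).trans (Polynomial.natDegree_map_le.trans ?_)
  rw [Polynomial.natDegree_hermite]
  exact h

lemma Hmulti_split (ν : ℕ →₀ ℕ) (s : Finset ℕ) (y : ℕ → ℝ) :
    Hmulti ν y = (∏ j ∈ ν.support \ s, Hnorm (ν j) (y j)) * ∏ j ∈ s, Hnorm (ν j) (y j) := by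
  have h1 : Hmulti ν y = ∏ j ∈ ν.support ∪ s, Hnorm (ν j) (y j) := by
    refine Finset.prod_subset Finset.subset_union_left ?_
    intro j _ hj
    rw [Finsupp.notMem_support_iff.mp hj, Hnorm_zero']
  rw [h1, ← Finset.sdiff_union_self_eq_union, Finset.prod_union Finset.sdiff_disjoint]

lemma tensor_Hmulti (Q : QuadFamily) (s : Finset ℕ) (lev : ℕ → ℕ) (ν : ℕ →₀ ℕ) :
    Q.tensor s lev (Hmulti ν) =
      (∏ j ∈ ν.support \ s, Hnorm (ν j) 0) * ∏ j ∈ s, Q.quad (lev j) (Hnorm (ν j)) := by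
  unfold QuadFamily.tensor QuadFamily.quad
  rw [Finset.prod_sum, Finset.mul_sum]
  refine Finset.sum_congr rfl fun k _ => ?_
  rw [Hmulti_split ν s]
  have h1 : (∏ j ∈ ν.support \ s, Hnorm (ν j)
      (if h : j ∈ s then Q.node (lev j) (k j h) else 0)) =
      ∏ j ∈ ν.support \ s, Hnorm (ν j) 0 := by
    refine Finset.prod_congr rfl fun j hj => ?_
    rw [dif_neg (Finset.mem_sdiff.mp hj).2]
  have h2 : (∏ j ∈ s, Hnorm (ν j)
      (if h : j ∈ s then Q.node (lev j) (k j h) else 0)) =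
      ∏ j ∈ s.attach, Hnorm (ν j.1) (Q.node (lev j.1) (k j.1 j.2)) := by
    rw [← Finset.prod_attach]
    refine Finset.prod_congr rfl fun j _ => ?_
    rw [dif_pos j.2]
  rw [h1, h2]
  simp only [smul_eq_mul, Finset.prod_mul_distrib]
  ring

lemma delta_Hmulti (Q : QuadFamily) (μ ν : ℕ →₀ ℕ) :
    Q.delta μ (Hmulti ν) = (∏ j ∈ ν.support \ μ.support, Hnorm (ν j) 0) *
      ∏ j ∈ μ.support, (-Q.quad (μ j - 1) (Hnorm (ν j)) + Q.quad (μ j) (Hnorm (ν j))) := by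
  unfold QuadFamily.delta
  rw [Finset.prod_add, Finset.mul_sum]
  refine Finset.sum_congr rfl fun T hT => ?_
  rw [tensor_Hmulti, ← Finset.prod_sdiff (Finset.mem_powerset.mp hT), Finset.prod_neg]
  have h1 : (∏ j ∈ T, Q.quad (μ j - (if j ∈ T then 1 else 0)) (Hnorm (ν j))) =
      ∏ j ∈ T, Q.quad (μ j - 1) (Hnorm (ν j)) :=
    Finset.prod_congr rfl fun j hj => by rw [if_pos hj]
  have h2 : (∏ j ∈ μ.support \ T, Q.quad (μ j - (if j ∈ T then 1 else 0)) (Hnorm (ν j))) =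
      ∏ j ∈ μ.support \ T, Q.quad (μ j) (Hnorm (ν j)) :=
    Finset.prod_congr rfl fun j hj => by rw [if_neg (Finset.mem_sdiff.mp hj).2, Nat.sub_zero]
  rw [h1, h2, smul_eq_mul]
  ring

lemma delta_Hmulti_eq_zero (Q : QuadFamily) (hA1 : Q.ExactA1) (ν μ : ℕ →₀ ℕ)
    (h : ¬ μ ≤ ν) : Q.delta μ (Hmulti ν) = 0 := by
  rw [Finsupp.le_def] at h
  push Not at h
  obtain ⟨j, hj⟩ := h
  rw [delta_Hmulti]
  refine mul_eq_zero_of_right _ (Finset.prod_eq_zero (i := j) ?_ ?_)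
  · rw [Finsupp.mem_support_iff]; omega
  · rw [quad_Hnorm_eq Q hA1 (by omega), quad_Hnorm_eq Q hA1 (by omega)]
    ring

/-- Localization: `Q_Λ(H_ν) = Q_{Λ ∩ R_ν}(H_ν)`, and `Δ_μ(H_ν) = 0` whenever `¬ μ ⪯ ν`. -/
theorem sparse_quadrature_hermite_localize
    (Q : QuadFamily) (hA1 : Q.ExactA1)
    (Λ : Finset (ℕ →₀ ℕ)) (hΛ : DownwardClosed (↑Λ : Set (ℕ →₀ ℕ)))
    (ν : ℕ →₀ ℕ) :
    Q.sparse Λ (Hmulti ν) = Q.sparse (Λ ∩ Finset.Iic ν) (Hmulti ν) ∧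
    ∀ μ : ℕ →₀ ℕ, ¬ μ ≤ ν → Q.delta μ (Hmulti ν) = 0 := by
  refine ⟨?_, fun μ h => delta_Hmulti_eq_zero Q hA1 ν μ h⟩
  symm
  refine Finset.sum_subset Finset.inter_subset_left fun μ hμ hn => ?_
  apply delta_Hmulti_eq_zero Q hA1
  intro hle
  exact hn (Finset.mem_inter.mpr ⟨hμ, Finset.mem_Iic.mpr hle⟩)
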